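/- Let X = (X_u)_{u∈V_2} be an allocation to V_2 with n ≥ 2 and let i ∈ V_1 be an agent such that (i, r) is not an edge of the PROPavg-graph G_X. Then there exist u* ∈ V_2 and a good g ∈ X_{u*} such that (i, u*) is an edge of G_X, |X_{u*}| ≥ 2, and if X' is the allocation obtained from X by moving g to X_r, then (i, u*) is an edge of the PROPavg-graph G_{X'}. -/

import Mathlib

open Finset
open scoped Classical

noncomputable section

variable {G : Type*}

/-- Value of a bundle under an additive valuation. -/
def val (v : G → ℝ) (S : Finset G) : ℝ := ∑ g ∈ S, v g

/-- Minimum value of a good in a bundle; `0` for the empty bundle. -/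
def minval (v : G → ℝ) (S : Finset G) : ℝ :=
  if h : S.Nonempty then S.inf' h v else 0

/-- `X` is a partition of the goods into `n` pairwise disjoint (possibly empty) bundles. -/
def IsAlloc {n : ℕ} (X : Fin n → Finset G) : Prop :=
  (∀ i j : Fin n, i ≠ j → Disjoint (X i) (X j)) ∧ (∀ g : G, ∃ i : Fin n, g ∈ X i)

/-- Agent `i` is PROPavg-satisfied by the allocation `X`. -/
def PROPavgSat {n : ℕ} (v : Fin n → G → ℝ) (X : Fin n → Finset G) (i : Fin n) : Prop :=
  val (v i) (X i) + (1 / ((n : ℝ) - 1)) * ∑ k ∈ Finset.univ.erase i, minval (v i) (X k)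
    ≥ 1 / (n : ℝ)

/-- Edge of the PROPavg-graph between agent `i ∈ V₁` and label `u ∈ V₂` (both parts
are indexed by `Fin n`, `r` is the distinguished element of `V₂`). -/
def Edge {n : ℕ} (v : Fin n → G → ℝ) (X : Fin n → Finset G) (r i u : Fin n) : Prop :=
  val (v i) (X u) + (1 / ((n : ℝ) - 1)) *
      ∑ u' ∈ (Finset.univ.erase r).erase u, minval (v i) (X u')
    ≥ 1 / (n : ℝ)

/-- `i` is one of the agents `1, …, n-1`, i.e. not the last agent. -/
def InV1 {n : ℕ} (i : Fin n) : Prop := (i : ℕ) < n - 1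

/-- The set `V₁` of the first `n-1` agents. -/
def V1 (n : ℕ) : Finset (Fin n) := Finset.univ.filter fun i => (i : ℕ) < n - 1

/-- A perfect matching of `V₁` onto `V₂ \ {u}` in the PROPavg-graph `G_X`,
i.e. a bijection from `V₁` to `V₂ \ {u}` all of whose pairs are edges. -/
def IsPM {n : ℕ} (v : Fin n → G → ℝ) (X : Fin n → Finset G) (r u : Fin n)
    (f : Fin n → Fin n) : Prop :=
  Set.InjOn f {i : Fin n | InV1 i} ∧
  (∀ i : Fin n, InV1 i → f i ≠ u ∧ Edge v X r i (f i)) ∧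
  (∀ w : Fin n, w ≠ u → ∃ i : Fin n, InV1 i ∧ f i = w)

/-- Property (P1): `G_X - r` has a perfect matching. -/
def P1 {n : ℕ} (v : Fin n → G → ℝ) (X : Fin n → Finset G) (r : Fin n) : Prop :=
  ∃ f : Fin n → Fin n, IsPM v X r r f

/-- Property (P2): for every `u ∈ V₂`, `G_X - u` has a perfect matching. -/
def P2 {n : ℕ} (v : Fin n → G → ℝ) (X : Fin n → Finset G) (r : Fin n) : Prop :=
  ∀ u : Fin n, ∃ f : Fin n → Fin n, IsPM v X r u f

/-- The neighborhood `Γ_{G_X}(S) ⊆ V₂` of a set `S ⊆ V₁` in the PROPavg-graph. -/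
def Nbr {n : ℕ} (v : Fin n → G → ℝ) (X : Fin n → Finset G) (r : Fin n)
    (S : Finset (Fin n)) : Finset (Fin n) :=
  Finset.univ.filter fun u => ∃ i ∈ S, Edge v X r i u

/-- The allocation obtained from `X` by moving the good `g ∈ X ustar` to `X r`. -/
def move {n : ℕ} [DecidableEq G] (X : Fin n → Finset G) (r ustar : Fin n) (g : G) :
    Fin n → Finset G :=
  fun u => if u = r then insert g (X r) else if u = ustar then (X ustar).erase g else X u

theorem minval_nonneg {v : G → ℝ} (hv : ∀ g, 0 ≤ v g) (S : Finset G) : 0 ≤ minval v S := by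
  unfold minval
  split_ifs with h
  · exact (Finset.le_inf'_iff h v).2 fun g _ => hv g
  · exact le_rfl

theorem val_eq_minval_of_card_le_one {v : G → ℝ} {S : Finset G} (hS : S.card ≤ 1) :
    val v S = minval v S := by
  rcases Nat.le_one_iff_eq_zero_or_eq_one.1 hS with h | h
  · simp [Finset.card_eq_zero.1 h, _root_.val, minval]
  · obtain ⟨g, rfl⟩ := Finset.card_eq_one.1 h
    simp [_root_.val, minval]

theorem IsAlloc.sum_val {G : Type*} [Fintype G] {n : ℕ} {X : Fin n → Finset G} (hX : IsAlloc X)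
    (v : G → ℝ) : ∑ u, val v (X u) = val v Finset.univ := by
  have hU : Finset.univ.biUnion X = Finset.univ := by
    ext g
    simpa using hX.2 g
  rw [← hU]
  exact (Finset.sum_biUnion fun a _ b _ hab => hX.1 a b hab).symm

/-- If `(i, r)` is not an edge, then by averaging some other bundle is still worth more than `1 / n`
after the loss of its least valuable good. -/
theorem exists_lt_val_sub_minval {G : Type*} [Fintype G] {n : ℕ} (hn : 2 ≤ n)
    (v : Fin n → G → ℝ) (X : Fin n → Finset G) (r i : Fin n)
    (hnorm : val (v i) (Finset.univ : Finset G) = 1)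
    (hX : IsAlloc X) (hir : ¬ Edge v X r i r) :
    ∃ u ≠ r, 1 / (n : ℝ) < val (v i) (X u) - minval (v i) (X u) + (1 / ((n : ℝ) - 1)) *
      ∑ u' ∈ (Finset.univ.erase r).erase u, minval (v i) (X u') := by
  have hn' : (2 : ℝ) ≤ n := by exact_mod_cast hn
  have hcard : ((Finset.univ.erase r).card : ℝ) = n - 1 := by
    rw [Finset.card_erase_of_mem (Finset.mem_univ r), Finset.card_fin,
      Nat.cast_sub (by lia), Nat.cast_one]
  have hval := hX.sum_val (v i)
  rw [hnorm, ← Finset.add_sum_erase _ _ (Finset.mem_univ r)] at hval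
  rw [Edge, Finset.erase_idem, ge_iff_le, not_le] at hir
  set S := ∑ u' ∈ Finset.univ.erase r, minval (v i) (X u') with hS
  have hlt : ∑ _u ∈ Finset.univ.erase r, 1 / (n : ℝ) < ∑ u ∈ Finset.univ.erase r,
      (val (v i) (X u) - minval (v i) (X u) +
        (1 / ((n : ℝ) - 1)) * (S - minval (v i) (X u))) := by
    rw [Finset.sum_add_distrib, Finset.sum_sub_distrib, ← Finset.mul_sum, Finset.sum_sub_distrib,
      Finset.sum_const, Finset.sum_const, nsmul_eq_mul, nsmul_eq_mul, hcard, ← hS]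
    have hl : ((n : ℝ) - 1) * (1 / n) = 1 - 1 / n := by field_simp
    have hr : 1 / ((n : ℝ) - 1) * (((n : ℝ) - 1) * S - S) = S - 1 / ((n : ℝ) - 1) * S := by
      have : (n : ℝ) - 1 ≠ 0 := by linarith
      field_simp
    rw [hl, hr]
    linarith
  obtain ⟨u, hu, h⟩ := Finset.exists_lt_of_sum_lt hlt
  refine ⟨u, Finset.ne_of_mem_erase hu, ?_⟩
  rwa [Finset.sum_erase_eq_sub hu]

/-- Lemma 5: if `(i, r)` is not an edge, then some good can be moved
to `X r` keeping an edge at `i`. -/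
theorem removable_good_exists {G : Type*} [Fintype G] [DecidableEq G] (n : ℕ) (hn : 2 ≤ n)
    (v : Fin n → G → ℝ) (X : Fin n → Finset G) (r : Fin n)
    (hpos : ∀ (i : Fin n) (g : G), 0 ≤ v i g)
    (hnorm : ∀ i : Fin n, val (v i) (Finset.univ : Finset G) = 1)
    (hX : IsAlloc X)
    (i : Fin n) (hi : InV1 i) (hir : ¬ Edge v X r i r) :
    ∃ (ustar : Fin n) (g : G), ustar ≠ r ∧ g ∈ X ustar ∧ Edge v X r i ustar ∧
      2 ≤ (X ustar).card ∧ Edge v (move X r ustar g) r i ustar := by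
  obtain ⟨u, hur, hu⟩ := exists_lt_val_sub_minval hn v X r i (hnorm i) hX hir
  have hn' : (2 : ℝ) ≤ n := by exact_mod_cast hn
  have hcard : 2 ≤ (X u).card := by
    by_contra! hc
    refine hir ?_
    rw [val_eq_minval_of_card_le_one (Nat.le_of_lt_succ hc), sub_self, zero_add] at hu
    have hle : ∑ u' ∈ (Finset.univ.erase r).erase u, minval (v i) (X u') ≤
        ∑ u' ∈ Finset.univ.erase r, minval (v i) (X u') :=
      Finset.sum_le_sum_of_subset_of_nonneg (Finset.erase_subset _ _)
        fun u' _ _ => minval_nonneg (hpos i) _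
    have hc0 : 0 ≤ 1 / ((n : ℝ) - 1) := one_div_nonneg.2 (by linarith)
    have hr : 0 ≤ val (v i) (X r) := Finset.sum_nonneg fun g _ => hpos i g
    rw [Edge, Finset.erase_idem]
    linarith [mul_le_mul_of_nonneg_left hle hc0]
  have hne : (X u).Nonempty := Finset.card_pos.1 (by lia)
  obtain ⟨g, hg, hgmin⟩ := Finset.exists_mem_eq_inf' hne (v i)
  have hmin : minval (v i) (X u) = v i g := by rw [minval, dif_pos hne, hgmin]
  refine ⟨u, g, hur, hg, ?_, hcard, ?_⟩
  · have := minval_nonneg (hpos i) (X u)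
    rw [Edge]
    linarith
  · have hmove : ∑ u' ∈ (Finset.univ.erase r).erase u, minval (v i) (move X r u g u') =
        ∑ u' ∈ (Finset.univ.erase r).erase u, minval (v i) (X u') := by
      refine Finset.sum_congr rfl fun u' hu' => ?_
      simp only [Finset.mem_erase] at hu'
      rw [move, if_neg hu'.2.1, if_neg hu'.1]
    have hval : val (v i) (move X r u g u) = val (v i) (X u) - minval (v i) (X u) := by
      rw [move, if_neg hur, if_pos rfl, hmin, _root_.val, _root_.val, Finset.sum_erase_eq_sub hg]
    rw [Edge, hmove, hval]
    exact hu.le
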